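/- arXiv:1910.04147 — 2 statements merged into one kernel-verified Lean document; each statement's English description precedes it below -/
import Mathlib

section
/- Let d, e ∈ ℕ₀ with d + 2 ≤ e, let f̄ = f₂(X)Y² + f₁(X)YZ + f₀(X)Z² ∈ C_{d,e}, let ℓ ∈ ℝ[X] with deg ℓ = 1, and define h ∈ ℝ[X,Y,Z] by h(X,Y,Z) = f̄(X, Y + ℓ(X)Z, Z) = f₂(X)Y² + h₁(X)YZ + h₀(X)Z². Then: (i) h ∈ C_{d,e}; (ii) if f̄ generates an extreme ray of C_{d,e}, then h generates an extreme ray of C_{d,e}; (iii) if (x₀,y₀,z₀), (x₁,y₁,z₁) ∈ S with x₀ ≠ x₁, z₀ ≠ 0, z₁ ≠ 0, y₀/z₀ ≠ y₁/z₁, f̄(x₀,y₀,z₀) = f̄(x₁,y₁,z₁) = 0 and ℓ(X) = ((y₁/z₁ − y₀/z₀)/(x₁ − x₀))·(X − x₀) + y₀/z₀, then h₀(x₀) = h₀(x₁) = 0; (iv) if h can be written as r(X)·(p(X)Y + q(X)Z)² with p and q not both zero and gcd(p,q) = 1, then f̄ = r(X)·(p(X)Y + (−ℓ(X)p(X) +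 q(X))Z)², where p and −ℓp + q are not both zero and gcd(p, −ℓp + q) = 1. -/
noncomputable def toMv (p : Polynomial ℝ) : MvPolynomial (Fin 3) ℝ :=
  Polynomial.aeval (MvPolynomial.X 0) p

def inS (x y z : ℝ) : Prop := x ∈ Set.Icc (0:ℝ) 1 ∧ (y, z) ≠ (0, 0)

noncomputable def quadForm (f₂ f₁ f₀ : Polynomial ℝ) : MvPolynomial (Fin 3) ℝ :=
  toMv f₂ * MvPolynomial.X 1 ^ 2 + toMv f₁ * MvPolynomial.X 1 * MvPolynomial.X 2
    + toMv f₀ * MvPolynomial.X 2 ^ 2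

def coneC (d e : ℕ) : Set (MvPolynomial (Fin 3) ℝ) :=
  {f | (∃ f₂ f₁ f₀ : Polynomial ℝ, f = quadForm f₂ f₁ f₀ ∧
          f₂.natDegree ≤ d ∧ f₁.natDegree ≤ (d + e) / 2 ∧ f₀.natDegree ≤ e) ∧
       ∀ x y z : ℝ, inS x y z → 0 ≤ MvPolynomial.eval ![x, y, z] f}

def genExtremeRay (d e : ℕ) (f : MvPolynomial (Fin 3) ℝ) : Prop :=
  f ≠ 0 ∧ f ∈ coneC d e ∧
    ∀ g h : MvPolynomial (Fin 3) ℝ, g ∈ coneC d e → h ∈ coneC d e → g + h = f →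
      (∃ c : ℝ, 0 ≤ c ∧ g = c • f) ∧ ∃ c : ℝ, 0 ≤ c ∧ h = c • f

open MvPolynomial

/-- The substitution `Y ↦ Y + ℓ(X) Z`. -/
noncomputable def shift (ℓ : Polynomial ℝ) :
    MvPolynomial (Fin 3) ℝ →ₐ[ℝ] MvPolynomial (Fin 3) ℝ :=
  aeval (![X 0, X 1 + toMv ℓ * X 2, X 2] : Fin 3 → MvPolynomial (Fin 3) ℝ)

section shift

variable (ℓ : Polynomial ℝ)

lemma shift_X_zero : shift ℓ (X 0) = X 0 := by simp [shift]

lemma shift_X_one : shift ℓ (X 1) = X 1 + toMv ℓ * X 2 := by simp [shift]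

lemma shift_X_two : shift ℓ (X 2) = X 2 := by simp [shift]

lemma shift_toMv (p : Polynomial ℝ) : shift ℓ (toMv p) = toMv p := by
  rw [toMv, ← Polynomial.aeval_algHom_apply, shift_X_zero]

lemma eval_toMv (p : Polynomial ℝ) (x y z : ℝ) :
    MvPolynomial.eval ![x, y, z] (toMv p) = p.eval x := by
  have h := Polynomial.aeval_algHom_apply
    (MvPolynomial.aeval ![x, y, z] : MvPolynomial (Fin 3) ℝ →ₐ[ℝ] ℝ) (X 0) p
  simpa [toMv, MvPolynomial.aeval_eq_eval] using h.symm

lemma eval_quadForm (f₂ f₁ f₀ : Polynomial ℝ) (x y z : ℝ) :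
    MvPolynomial.eval ![x, y, z] (quadForm f₂ f₁ f₀)
      = f₂.eval x * y ^ 2 + f₁.eval x * y * z + f₀.eval x * z ^ 2 := by
  simp [quadForm, eval_toMv]

lemma shift_quadForm (f₂ f₁ f₀ : Polynomial ℝ) :
    shift ℓ (quadForm f₂ f₁ f₀)
      = quadForm f₂ (2 * ℓ * f₂ + f₁) (f₂ * ℓ ^ 2 + f₁ * ℓ + f₀) := by
  simp only [quadForm, map_add, map_mul, map_pow, shift_toMv, shift_X_one, shift_X_two]
  simp only [toMv, map_add, map_mul, map_pow, map_ofNat]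
  ring

lemma shift_neg_shift (f : MvPolynomial (Fin 3) ℝ) : shift (-ℓ) (shift ℓ f) = f := by
  have h : (shift (-ℓ)).comp (shift ℓ) = AlgHom.id ℝ _ := by
    ext1 i
    fin_cases i
    · simp [shift_X_zero]
    · simp [shift_X_one, shift_X_two, shift_toMv]
      simp [toMv]
    · simp [shift_X_two]
  exact DFunLike.congr_fun h f

lemma shift_shift_neg (f : MvPolynomial (Fin 3) ℝ) : shift ℓ (shift (-ℓ) f) = f := by
  simpa using shift_neg_shift (-ℓ) f

lemma inS_shear {x y z : ℝ} (t : ℝ) (h : inS x y z) : inS x (y + t * z) z := by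
  refine ⟨h.1, fun h0 => h.2 ?_⟩
  obtain ⟨hy, hz⟩ := Prod.mk.inj h0
  subst hz
  simpa using hy

variable {ℓ}

lemma shift_mem_coneC {d e : ℕ} (hde : d + 2 ≤ e) (hℓ : ℓ.natDegree ≤ 1)
    {f : MvPolynomial (Fin 3) ℝ} (hf : f ∈ coneC d e) : shift ℓ f ∈ coneC d e := by
  obtain ⟨⟨f₂, f₁, f₀, rfl, h2, h1, h0⟩, hpos⟩ := hf
  refine ⟨⟨_, _, _, shift_quadForm ℓ f₂ f₁ f₀, h2, ?_, ?_⟩, fun x y z hS => ?_⟩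
  · have h2ℓ : (2 * ℓ * f₂).natDegree ≤ 0 + 1 + d :=
      Polynomial.natDegree_mul_le_of_le
        (Polynomial.natDegree_mul_le_of_le (Polynomial.natDegree_ofNat 2).le hℓ) h2
    exact Polynomial.natDegree_add_le_of_degree_le (h2ℓ.trans (by omega)) h1
  · have hA : (f₂ * ℓ ^ 2).natDegree ≤ d + 2 * 1 :=
      Polynomial.natDegree_mul_le_of_le h2 (Polynomial.natDegree_pow_le_of_le 2 hℓ)
    have hB : (f₁ * ℓ).natDegree ≤ (d + e) / 2 + 1 :=
      Polynomial.natDegree_mul_le_of_le h1 hℓ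
    exact Polynomial.natDegree_add_le_of_degree_le
      (Polynomial.natDegree_add_le_of_degree_le (hA.trans (by omega)) (hB.trans (by omega))) h0
  · have h := hpos _ _ _ (inS_shear (ℓ.eval x) hS)
    rw [eval_quadForm] at h
    rw [shift_quadForm, eval_quadForm]
    simp only [Polynomial.eval_add, Polynomial.eval_mul, Polynomial.eval_pow,
      Polynomial.eval_ofNat]
    linarith

lemma genExtremeRay.shift {d e : ℕ} (hde : d + 2 ≤ e) (hℓ : ℓ.natDegree ≤ 1)
    {f : MvPolynomial (Fin 3) ℝ} (hf : genExtremeRay d e f) :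
    genExtremeRay d e (shift ℓ f) := by
  obtain ⟨hne, hmem, hext⟩ := hf
  have hℓ' : (-ℓ).natDegree ≤ 1 := by rwa [Polynomial.natDegree_neg]
  refine ⟨fun h0 => hne ?_, shift_mem_coneC hde hℓ hmem, fun g h hg hh hgh => ?_⟩
  · rw [← shift_neg_shift ℓ f, h0, map_zero]
  · obtain ⟨⟨a, ha, hga⟩, b, hb, hhb⟩ :=
      hext _ _ (shift_mem_coneC hde hℓ' hg) (shift_mem_coneC hde hℓ' hh)
        (by rw [← map_add, hgh, shift_neg_shift])
    refine ⟨⟨a, ha, ?_⟩, b, hb, ?_⟩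
    · rw [← map_smul, ← hga, shift_shift_neg]
    · rw [← map_smul, ← hhb, shift_shift_neg]

lemma eval_eq_zero_of_eval_quadForm_eq_zero {f₂ f₁ f₀ h₁ h₀ : Polynomial ℝ}
    (hh : _root_.shift ℓ (quadForm f₂ f₁ f₀) = quadForm f₂ h₁ h₀) {x y z : ℝ} (hz : z ≠ 0)
    (hℓ : ℓ.eval x = y / z) (hf : MvPolynomial.eval ![x, y, z] (quadForm f₂ f₁ f₀) = 0) :
    h₀.eval x = 0 := by
  have h := congrArg (MvPolynomial.eval ![x, 0, 1]) hh
  rw [shift_quadForm, eval_quadForm, eval_quadForm] at h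
  rw [eval_quadForm] at hf
  simp only [Polynomial.eval_add, Polynomial.eval_mul, Polynomial.eval_pow, hℓ] at h
  have key : f₂.eval x * (y / z) ^ 2 + f₁.eval x * (y / z) + f₀.eval x = 0 := by
    field_simp
    linarith
  linarith

end shift

theorem stmt_8 (d e : ℕ) (hde : d + 2 ≤ e) (f₂ f₁ f₀ h₁ h₀ ℓ : Polynomial ℝ)
    (hℓ : ℓ.degree = 1)
    (hf : quadForm f₂ f₁ f₀ ∈ coneC d e)
    (hh : MvPolynomial.aeval
        (![MvPolynomial.X 0, MvPolynomial.X 1 + toMv ℓ * MvPolynomial.X 2,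
           MvPolynomial.X 2] : Fin 3 → MvPolynomial (Fin 3) ℝ)
        (quadForm f₂ f₁ f₀) = quadForm f₂ h₁ h₀) :
    quadForm f₂ h₁ h₀ ∈ coneC d e ∧
    (genExtremeRay d e (quadForm f₂ f₁ f₀) → genExtremeRay d e (quadForm f₂ h₁ h₀)) ∧
    (∀ x₀ y₀ z₀ x₁ y₁ z₁ : ℝ, inS x₀ y₀ z₀ → inS x₁ y₁ z₁ →
      x₀ ≠ x₁ → z₀ ≠ 0 → z₁ ≠ 0 → y₀ / z₀ ≠ y₁ / z₁ →
      MvPolynomial.eval ![x₀, y₀, z₀] (quadForm f₂ f₁ f₀) = 0 →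
      MvPolynomial.eval ![x₁, y₁, z₁] (quadForm f₂ f₁ f₀) = 0 →
      ℓ = Polynomial.C ((y₁ / z₁ - y₀ / z₀) / (x₁ - x₀))
            * (Polynomial.X - Polynomial.C x₀) + Polynomial.C (y₀ / z₀) →
      h₀.eval x₀ = 0 ∧ h₀.eval x₁ = 0) ∧
    (∀ r p q : Polynomial ℝ, ¬(p = 0 ∧ q = 0) → IsCoprime p q →
      quadForm f₂ h₁ h₀
        = toMv r * (toMv p * MvPolynomial.X 1 + toMv q * MvPolynomial.X 2) ^ 2 →
      quadForm f₂ f₁ f₀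
          = toMv r * (toMv p * MvPolynomial.X 1
              + toMv (-ℓ * p + q) * MvPolynomial.X 2) ^ 2 ∧
        ¬(p = 0 ∧ -ℓ * p + q = 0) ∧
        IsCoprime p (-ℓ * p + q)) := by
  replace hh : shift ℓ (quadForm f₂ f₁ f₀) = quadForm f₂ h₁ h₀ := hh
  have hℓ' : ℓ.natDegree ≤ 1 := Polynomial.natDegree_le_of_degree_le hℓ.le
  refine ⟨hh ▸ shift_mem_coneC hde hℓ' hf, fun h => hh ▸ h.shift hde hℓ', ?_, ?_⟩
  · intro x₀ y₀ z₀ x₁ y₁ z₁ _ _ hx hz₀ hz₁ _ hf₀ hf₁ hℓeq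
    have hx' : x₁ - x₀ ≠ 0 := sub_ne_zero.2 hx.symm
    refine ⟨eval_eq_zero_of_eval_quadForm_eq_zero hh hz₀ ?_ hf₀,
      eval_eq_zero_of_eval_quadForm_eq_zero hh hz₁ ?_ hf₁⟩
    · simp [hℓeq]
    · simp [hℓeq, div_mul_cancel₀ _ hx']
  · intro r p q hpq hcop heq
    refine ⟨?_, ?_, ?_⟩
    · rw [← shift_neg_shift ℓ (quadForm f₂ f₁ f₀), hh, heq]
      simp only [map_add, map_mul, map_pow, shift_toMv, shift_X_one, shift_X_two]
      simp only [toMv, map_add, map_mul, map_neg]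
      ring
    · rintro ⟨rfl, hq⟩
      exact hpq ⟨rfl, by simpa using hq⟩
    · rw [add_comm]
      exact hcop.add_mul_right_right (-ℓ)
end

section
/- Let f ∈ ℝ[X,Y] with d = deg_X f and m = deg_Y f, and let N ∈ ℕ₀ be such that b_j ≥ 0 on C for every 0 ≤ j ≤ N + d. Then there exist sums of squares σ₀, σ₁ in ℝ[X,Y] such that f = σ₀ + σ₁·X(1−X) and deg(σ₀) ≤ N + d + m + 1 and deg(σ₁·X(1−X)) ≤ N + d + m + 1. -/
open Finset

/-- The homogenization-lift `F ∈ ℝ[W,X,Y,Z]` of `f ∈ ℝ[X,Y]` (variables `W=0, X=1, Y=2, Z=3`):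
`F = Σ_{0≤i≤m} Σ_{0≤j≤d} a_{ji} X^j (W+X)^{d−j} Y^i Z^{m−i}`. -/
noncomputable def Fhom (d m : ℕ) (f : MvPolynomial (Fin 2) ℝ) : MvPolynomial (Fin 4) ℝ :=
  ∑ i ∈ range (m + 1), ∑ j ∈ range (d + 1),
    MvPolynomial.C (MvPolynomial.coeff (Finsupp.single 0 j + Finsupp.single 1 i) f) *
      MvPolynomial.X 1 ^ j * (MvPolynomial.X 0 + MvPolynomial.X 1) ^ (d - j) *
      MvPolynomial.X 2 ^ i * MvPolynomial.X 3 ^ (m - i)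

/-- `b : ℕ → ℝ[Y,Z]` (variables `Y=0, Z=1`) is the family of coefficient polynomials defined by
`(W+X)^N F = Σ_{0≤j≤N+d} b_j(Y,Z) W^j X^{N+d−j}`. -/
def bFamily (d m N : ℕ) (f : MvPolynomial (Fin 2) ℝ)
    (b : ℕ → MvPolynomial (Fin 2) ℝ) : Prop :=
  (MvPolynomial.X 0 + MvPolynomial.X 1 : MvPolynomial (Fin 4) ℝ) ^ N * Fhom d m f =
    ∑ j ∈ range (N + d + 1),
      MvPolynomial.rename (![2, 3] : Fin 2 → Fin 4) (b j) *
        MvPolynomial.X 0 ^ j * MvPolynomial.X 1 ^ (N + d - j)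

/-- A real univariate polynomial that is nonnegative with a zero at `a` is divisible by
`(X - a) ^ 2`, with nonnegative quotient. -/
theorem Polynomial.exists_eq_sq_mul_of_nonneg {p : Polynomial ℝ} (hp : ∀ x, 0 ≤ p.eval x) {a : ℝ}
    (ha : p.eval a = 0) :
    ∃ q : Polynomial ℝ, p = (Polynomial.X - Polynomial.C a) ^ 2 * q ∧ ∀ x, 0 ≤ q.eval x := by
  obtain ⟨g, rfl⟩ := Polynomial.dvd_iff_isRoot.mpr ha
  have hmin : IsLocalMin (fun x => ((Polynomial.X - Polynomial.C a) * g).eval x) a :=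
    Filter.Eventually.of_forall fun x => by simpa only [ha] using hp x
  have hg : g.eval a = 0 := by
    have := hmin.deriv_eq_zero
    rw [Polynomial.deriv] at this
    simpa using this
  obtain ⟨q, rfl⟩ := Polynomial.dvd_iff_isRoot.mpr hg
  refine ⟨q, by ring, fun x => ?_⟩
  have hclosed : IsClosed {x | 0 ≤ q.eval x} := isClosed_le continuous_const q.continuous
  refine (dense_compl_singleton a).closure_eq ▸ hclosed.closure_subset_iff.mpr ?_ <| Set.mem_univ x
  intro y hy
  have hy' : y - a ≠ 0 := sub_ne_zero.mpr hy
  have h := hp y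
  simp only [Polynomial.eval_mul, Polynomial.eval_sub, Polynomial.eval_X, Polynomial.eval_C,
    ← mul_assoc] at h
  exact nonneg_of_mul_nonneg_right h (mul_self_pos.mpr hy')

/-- A nonnegative real univariate polynomial is a sum of squares. -/
theorem Polynomial.isSumSq_of_nonneg (p : Polynomial ℝ) (hp : ∀ x, 0 ≤ p.eval x) :
    IsSumSq p := by
  induction hn : p.natDegree using Nat.strong_induction_on generalizing p with
  | _ n ih =>
  obtain ⟨a, ha⟩ := p.exists_forall_norm_le
  simp only [Real.norm_of_nonneg (hp _)] at ha
  obtain ⟨q, hq, hq0⟩ := Polynomial.exists_eq_sq_mul_of_nonneg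
    (p := p - Polynomial.C (p.eval a)) (a := a) (fun x => by simpa using ha x) (by simp)
  have hc : IsSumSq (Polynomial.C (p.eval a)) := by
    rw [← Real.mul_self_sqrt (hp a), Polynomial.C_mul]
    exact .mul_self _
  have hqs : IsSumSq q := by
    rcases eq_or_ne q 0 with rfl | hne
    · exact .zero
    · refine ih q.natDegree ?_ q hq0 rfl
      have h := congrArg Polynomial.natDegree hq
      rw [Polynomial.natDegree_sub_C, Polynomial.natDegree_mul
        (pow_ne_zero _ (Polynomial.X_sub_C_ne_zero a)) hne, Polynomial.natDegree_pow,
        Polynomial.natDegree_X_sub_C] at h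
      omega
  rw [sub_eq_iff_eq_add.mp hq, sq]
  exact ((IsSumSq.mul_self _).mul hqs).add hc

theorem IsSumSq.map_ringHom {R S : Type*} [Semiring R] [Semiring S] (φ : R →+* S) {s : R}
    (hs : IsSumSq s) : IsSumSq (φ s) := by
  induction hs with
  | zero => simp
  | sq_add a _ ih => simpa using IsSumSq.sq_add (φ a) ih

/-- Closed formula for the coefficient polynomials, evaluated in any real algebra. -/
theorem bFamily.aeval_eq {d m N : ℕ} {f : MvPolynomial (Fin 2) ℝ}
    {b : ℕ → MvPolynomial (Fin 2) ℝ} (hb : bFamily d m N f b) {j : ℕ} (hj : j ≤ N + d)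
    {A : Type*} [CommRing A] [Algebra ℝ A] (y z : A) :
    MvPolynomial.aeval ![y, z] (b j) = ∑ i ∈ range (m + 1), ∑ k ∈ range (d + 1),
      algebraMap ℝ A (MvPolynomial.coeff (Finsupp.single 0 k + Finsupp.single 1 i) f) *
        ((N + (d - k)).choose j : A) * y ^ i * z ^ (m - i) := by
  have hren (p : MvPolynomial (Fin 2) ℝ) :
      MvPolynomial.aeval (![Polynomial.X, 1, Polynomial.C y, Polynomial.C z] : Fin 4 → Polynomial A)
        (MvPolynomial.rename (![2, 3] : Fin 2 → Fin 4) p) =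
      Polynomial.C (MvPolynomial.aeval ![y, z] p) := by
    rw [MvPolynomial.aeval_rename]
    change _ = Polynomial.CAlgHom (R := ℝ) (MvPolynomial.aeval ![y, z] p)
    rw [MvPolynomial.comp_aeval_apply]
    congr 2
    funext i
    fin_cases i <;> rfl
  have h := congrArg (MvPolynomial.aeval
    (![Polynomial.X, 1, Polynomial.C y, Polynomial.C z] : Fin 4 → Polynomial A)) hb
  rw [Fhom] at h
  simp only [map_mul, map_pow, map_add, map_sum, hren, MvPolynomial.aeval_X,
    MvPolynomial.algHom_C, Matrix.cons_val, one_pow, mul_one, Polynomial.algebraMap_apply] at h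
  have h' := congrArg (fun p => Polynomial.coeff p j) h
  simp only [Polynomial.finsetSum_coeff, Polynomial.coeff_C_mul, Polynomial.coeff_X_pow,
    mul_ite, mul_one, mul_zero, Finset.sum_ite_eq, Finset.mem_range] at h'
  rw [if_pos (by omega)] at h'
  rw [← h', Finset.mul_sum, Polynomial.finsetSum_coeff]
  refine Finset.sum_congr rfl fun i _ => ?_
  rw [Finset.mul_sum, Polynomial.finsetSum_coeff]
  refine Finset.sum_congr rfl fun k _ => ?_
  have : (Polynomial.X + 1 : Polynomial A) ^ N *
      (Polynomial.C (algebraMap ℝ A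
        (MvPolynomial.coeff (Finsupp.single 0 k + Finsupp.single 1 i) f)) *
        (Polynomial.X + 1) ^ (d - k) * Polynomial.C y ^ i * Polynomial.C z ^ (m - i)) =
      Polynomial.C (algebraMap ℝ A
        (MvPolynomial.coeff (Finsupp.single 0 k + Finsupp.single 1 i) f) * y ^ i * z ^ (m - i)) *
        (Polynomial.X + 1) ^ (N + (d - k)) := by
    simp only [Polynomial.C_mul, Polynomial.C_pow, pow_add]
    ring
  rw [this, Polynomial.coeff_C_mul, Polynomial.coeff_X_add_one_pow]
  ring

theorem MvPolynomial.eq_sum_range_degreeOf (f : MvPolynomial (Fin 2) ℝ) :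
    f = ∑ i ∈ range (degreeOf 1 f + 1), ∑ j ∈ range (degreeOf 0 f + 1),
      C (coeff (Finsupp.single 0 j + Finsupp.single 1 i) f) * X 0 ^ j * X 1 ^ i := by
  have hmon (i j : ℕ) (a : ℝ) : C a * X 0 ^ j * X 1 ^ i =
      monomial (Finsupp.single (0 : Fin 2) j + Finsupp.single 1 i) a := by
    rw [X_pow_eq_monomial, X_pow_eq_monomial, mul_assoc, monomial_mul, C_mul_monomial]
    simp
  ext e
  have he (i j : ℕ) : Finsupp.single (0 : Fin 2) j + Finsupp.single 1 i = e ↔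
      i = e 1 ∧ j = e 0 := by
    rw [Finsupp.ext_iff, Fin.forall_fin_two]
    simp [and_comm]
  have he' : Finsupp.single (0 : Fin 2) (e 0) + Finsupp.single 1 (e 1) = e := by simp [he]
  simp only [hmon, coeff_sum, coeff_monomial, he, ite_and]
  by_cases hs : e ∈ f.support
  · have h0 := le_degreeOf_of_mem_support 0 hs
    have h1 := le_degreeOf_of_mem_support 1 hs
    rw [Finset.sum_eq_single_of_mem (e 1) (by simpa [Nat.lt_succ_iff] using h1)
      (fun i _ hi => by simp [hi]), Finset.sum_eq_single_of_mem (e 0)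
      (by simpa [Nat.lt_succ_iff] using h0) (fun i _ hi => by simp [hi])]
    simp [he']
  · rw [notMem_support_iff] at hs
    rw [hs]
    refine (Finset.sum_eq_zero fun i _ => Finset.sum_eq_zero fun j _ => ?_).symm
    split_ifs with hi hj
    · rw [hi, hj, he', hs]
    · rfl
    · rfl

/-- Dehomogenization at `W = 1 - X`, `Z = 1`. -/
theorem bFamily.eq_sum {d m N : ℕ} {f : MvPolynomial (Fin 2) ℝ}
    (hd : d = MvPolynomial.degreeOf 0 f) (hm : m = MvPolynomial.degreeOf 1 f)
    {b : ℕ → MvPolynomial (Fin 2) ℝ} (hb : bFamily d m N f b) :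
    f = ∑ j ∈ range (N + d + 1),
      MvPolynomial.aeval ![(MvPolynomial.X 1 : MvPolynomial (Fin 2) ℝ), 1] (b j) *
        (1 - MvPolynomial.X 0) ^ j * MvPolynomial.X 0 ^ (N + d - j) := by
  have h := congrArg (MvPolynomial.aeval
    (![1 - MvPolynomial.X 0, MvPolynomial.X 0, MvPolynomial.X 1, 1] :
      Fin 4 → MvPolynomial (Fin 2) ℝ)) hb
  rw [Fhom] at h
  have hcomp : (![1 - MvPolynomial.X 0, MvPolynomial.X 0, MvPolynomial.X 1, 1] :
      Fin 4 → MvPolynomial (Fin 2) ℝ) ∘ (![2, 3] : Fin 2 → Fin 4) = ![MvPolynomial.X 1, 1] := by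
    funext i
    fin_cases i <;> rfl
  simp only [map_mul, map_pow, map_add, map_sum, MvPolynomial.aeval_rename, hcomp,
    MvPolynomial.aeval_X, MvPolynomial.algHom_C, MvPolynomial.algebraMap_eq, Matrix.cons_val,
    sub_add_cancel, one_pow, one_mul, mul_one] at h
  rw [← h, hd, hm]
  exact f.eq_sum_range_degreeOf

theorem bFamily.eval_nonneg {d m N : ℕ} {f : MvPolynomial (Fin 2) ℝ}
    {b : ℕ → MvPolynomial (Fin 2) ℝ} (hb : bFamily d m N f b) {j : ℕ} (hj : j ≤ N + d)
    (hpos : ∀ y z : ℝ, y ^ 2 + z ^ 2 = 1 → 0 ≤ MvPolynomial.eval ![y, z] (b j)) (y : ℝ) :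
    0 ≤ MvPolynomial.eval ![y, 1] (b j) := by
  set r := √(y ^ 2 + 1)
  have hr : 0 < r := by positivity
  have hr2 : r ^ 2 = y ^ 2 + 1 := Real.sq_sqrt (by positivity)
  have h := hpos (y / r) (1 / r) (by field_simp; exact hr2.symm)
  have key : MvPolynomial.eval ![y, 1] (b j) =
      r ^ m * MvPolynomial.eval ![y / r, 1 / r] (b j) := by
    rw [← MvPolynomial.aeval_eq_eval, ← MvPolynomial.aeval_eq_eval, hb.aeval_eq hj, hb.aeval_eq hj, Finset.mul_sum]
    refine Finset.sum_congr rfl fun i hi => ?_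
    rw [Finset.mul_sum]
    refine Finset.sum_congr rfl fun k _ => ?_
    rw [← pow_mul_pow_sub r (Nat.lt_succ_iff.mp (Finset.mem_range.mp hi)), div_pow, div_pow]
    field_simp
  rw [key]
  positivity

theorem bFamily.isSumSq_aeval {d m N : ℕ} {f : MvPolynomial (Fin 2) ℝ}
    {b : ℕ → MvPolynomial (Fin 2) ℝ} (hb : bFamily d m N f b) {j : ℕ} (hj : j ≤ N + d)
    (hpos : ∀ y z : ℝ, y ^ 2 + z ^ 2 = 1 → 0 ≤ MvPolynomial.eval ![y, z] (b j)) :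
    IsSumSq (MvPolynomial.aeval ![(MvPolynomial.X 1 : MvPolynomial (Fin 2) ℝ), 1] (b j)) := by
  have hB : IsSumSq (MvPolynomial.aeval ![(Polynomial.X : Polynomial ℝ), 1] (b j)) := by
    refine Polynomial.isSumSq_of_nonneg _ fun y => ?_
    convert hb.eval_nonneg hj hpos y
    rw [← Polynomial.coe_aeval_eq_eval, MvPolynomial.comp_aeval_apply,
      ← MvPolynomial.aeval_eq_eval]
    congr 2
    funext i
    fin_cases i <;> simp
  have h := hB.map_ringHom
    (Polynomial.aeval (R := ℝ) (MvPolynomial.X 1 : MvPolynomial (Fin 2) ℝ) :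
      Polynomial ℝ →+* MvPolynomial (Fin 2) ℝ)
  have hvars : (fun i => Polynomial.aeval (R := ℝ) (MvPolynomial.X 1 : MvPolynomial (Fin 2) ℝ)
      ((![Polynomial.X, 1] : Fin 2 → Polynomial ℝ) i)) = ![MvPolynomial.X 1, 1] := by
    funext i
    fin_cases i <;> simp
  rwa [RingHom.coe_coe, MvPolynomial.comp_aeval_apply, hvars] at h

theorem bFamily.totalDegree_aeval_le {d m N : ℕ} {f : MvPolynomial (Fin 2) ℝ}
    {b : ℕ → MvPolynomial (Fin 2) ℝ} (hb : bFamily d m N f b) {j : ℕ} (hj : j ≤ N + d) :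
    (MvPolynomial.aeval ![(MvPolynomial.X 1 : MvPolynomial (Fin 2) ℝ), 1] (b j)).totalDegree
      ≤ m := by
  rw [hb.aeval_eq hj]
  refine MvPolynomial.totalDegree_finsetSum_le fun i hi =>
    MvPolynomial.totalDegree_finsetSum_le fun k _ => ?_
  rw [one_pow, mul_one, MvPolynomial.algebraMap_eq, ← map_natCast MvPolynomial.C, ← map_mul]
  refine (MvPolynomial.totalDegree_mul _ _).trans ?_
  rw [MvPolynomial.totalDegree_C, MvPolynomial.totalDegree_X_pow]
  simp only [Finset.mem_range] at hi
  omega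

/-- `f` lies in the quadratic module of `X (1 - X)`, with both summands of degree at most `D`. -/
def HasStripCertificate (D : ℕ) (f : MvPolynomial (Fin 2) ℝ) : Prop :=
  ∃ σ₀ σ₁ : MvPolynomial (Fin 2) ℝ, IsSumSq σ₀ ∧ IsSumSq σ₁ ∧
    f = σ₀ + σ₁ * (MvPolynomial.X 0 * (1 - MvPolynomial.X 0)) ∧
    σ₀.totalDegree ≤ D ∧
    (σ₁ * (MvPolynomial.X 0 * (1 - MvPolynomial.X 0))).totalDegree ≤ D

namespace HasStripCertificate

variable {D : ℕ} {f g : MvPolynomial (Fin 2) ℝ}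

theorem of_isSumSq (hf : IsSumSq f) (hD : f.totalDegree ≤ D) : HasStripCertificate D f :=
  ⟨f, 0, hf, .zero, by simp, hD, by simp⟩

theorem of_isSumSq_mul (hf : IsSumSq f)
    (hD : (f * (MvPolynomial.X 0 * (1 - MvPolynomial.X 0))).totalDegree ≤ D) :
    HasStripCertificate D (f * (MvPolynomial.X 0 * (1 - MvPolynomial.X 0))) :=
  ⟨0, f, .zero, hf, by simp, by simp, hD⟩

theorem add (hf : HasStripCertificate D f) (hg : HasStripCertificate D g) :
    HasStripCertificate D (f + g) := by
  obtain ⟨s, t, hs, ht, rfl, hsD, htD⟩ := hf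
  obtain ⟨s', t', hs', ht', rfl, hsD', htD'⟩ := hg
  refine ⟨s + s', t + t', hs.add hs', ht.add ht', by ring,
    (MvPolynomial.totalDegree_add _ _).trans (max_le hsD hsD'), ?_⟩
  rw [add_mul]
  exact (MvPolynomial.totalDegree_add _ _).trans (max_le htD htD')

theorem sum {ι : Type*} {s : Finset ι} {F : ι → MvPolynomial (Fin 2) ℝ}
    (h : ∀ i ∈ s, HasStripCertificate D (F i)) : HasStripCertificate D (∑ i ∈ s, F i) :=
  Finset.sum_induction F _ (fun _ _ => add) (of_isSumSq .zero (by simp)) h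

theorem mul_pow_mul_pow {B : MvPolynomial (Fin 2) ℝ} (hB : IsSumSq B) {m : ℕ}
    (hm : B.totalDegree ≤ m) (j k : ℕ) :
    HasStripCertificate (j + k + m + 1)
      (B * (1 - MvPolynomial.X 0) ^ j * MvPolynomial.X 0 ^ k) := by
  have hdeg (p q : ℕ) :
      (B * (1 - MvPolynomial.X 0) ^ p * MvPolynomial.X 0 ^ q).totalDegree ≤ p + q + m := by
    have hW : (1 - MvPolynomial.X 0 : MvPolynomial (Fin 2) ℝ).totalDegree ≤ 1 :=
      (MvPolynomial.totalDegree_sub _ _).trans (by simp)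
    have h1 := (MvPolynomial.totalDegree_pow (1 - MvPolynomial.X 0 : MvPolynomial (Fin 2) ℝ)
      p).trans (Nat.mul_le_mul_left p hW)
    refine (MvPolynomial.totalDegree_mul _ _).trans ?_
    have h2 := MvPolynomial.totalDegree_mul B ((1 - MvPolynomial.X 0) ^ p)
    rw [MvPolynomial.totalDegree_X_pow]
    omega
  have hsq (p q : ℕ) :
      IsSumSq (B * (1 - MvPolynomial.X 0) ^ (p + p) * MvPolynomial.X 0 ^ (q + q)) := by
    rw [pow_add, pow_add]
    exact (hB.mul (.mul_self _)).mul (.mul_self _)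
  have even_even {D : ℕ} (p q : ℕ) (hD : p + p + (q + q) + m ≤ D) : HasStripCertificate D
      (B * (1 - MvPolynomial.X 0) ^ (p + p) * MvPolynomial.X 0 ^ (q + q)) :=
    of_isSumSq (hsq p q) ((hdeg _ _).trans hD)
  have odd_odd {D : ℕ} (p q : ℕ) (hD : p + p + (q + q) + m + 2 ≤ D) : HasStripCertificate D
      (B * (1 - MvPolynomial.X 0) ^ (p + p + 1) * MvPolynomial.X 0 ^ (q + q + 1)) := by
    have h : B * (1 - MvPolynomial.X 0) ^ (p + p + 1) * MvPolynomial.X 0 ^ (q + q + 1) =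
        B * (1 - MvPolynomial.X 0) ^ (p + p) * MvPolynomial.X 0 ^ (q + q) *
          (MvPolynomial.X 0 * (1 - MvPolynomial.X 0)) := by ring
    rw [h]
    refine of_isSumSq_mul (hsq p q) ?_
    rw [← h]
    exact (hdeg _ _).trans (by omega)
  rcases Nat.even_or_odd' j with ⟨p, rfl | rfl⟩ <;> rcases Nat.even_or_odd' k with ⟨q, rfl | rfl⟩ <;>
    simp only [two_mul]
  · exact even_even p q (by omega)
  · have h : B * (1 - MvPolynomial.X 0) ^ (p + p) * MvPolynomial.X 0 ^ (q + q + 1) =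
        B * (1 - MvPolynomial.X 0) ^ (p + p) * MvPolynomial.X 0 ^ (q + 1 + (q + 1)) +
        B * (1 - MvPolynomial.X 0) ^ (p + p + 1) * MvPolynomial.X 0 ^ (q + q + 1) := by ring
    rw [h]
    exact (even_even p (q + 1) (by omega)).add (odd_odd p q (by omega))
  · have h : B * (1 - MvPolynomial.X 0) ^ (p + p + 1) * MvPolynomial.X 0 ^ (q + q) =
        B * (1 - MvPolynomial.X 0) ^ (p + 1 + (p + 1)) * MvPolynomial.X 0 ^ (q + q) +
        B * (1 - MvPolynomial.X 0) ^ (p + p + 1) * MvPolynomial.X 0 ^ (q + q + 1) := by ring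
    rw [h]
    exact (even_even (p + 1) q (by omega)).add (odd_odd p q (by omega))
  · exact odd_odd p q (by omega)

end HasStripCertificate

theorem stmt_10 (f : MvPolynomial (Fin 2) ℝ) (d m N : ℕ)
    (hd : d = MvPolynomial.degreeOf 0 f) (hm : m = MvPolynomial.degreeOf 1 f)
    (b : ℕ → MvPolynomial (Fin 2) ℝ) (hb : bFamily d m N f b)
    (hbpos : ∀ j ≤ N + d, ∀ y z : ℝ, y ^ 2 + z ^ 2 = 1 →
      0 ≤ MvPolynomial.eval ![y, z] (b j)) :
    ∃ σ₀ σ₁ : MvPolynomial (Fin 2) ℝ, IsSumSq σ₀ ∧ IsSumSq σ₁ ∧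
      f = σ₀ + σ₁ * (MvPolynomial.X 0 * (1 - MvPolynomial.X 0)) ∧
      σ₀.totalDegree ≤ N + d + m + 1 ∧
      (σ₁ * (MvPolynomial.X 0 * (1 - MvPolynomial.X 0))).totalDegree ≤ N + d + m + 1 := by
  change HasStripCertificate (N + d + m + 1) f
  rw [hb.eq_sum hd hm]
  refine .sum fun j hj => ?_
  have hj : j ≤ N + d := Nat.lt_succ_iff.mp (Finset.mem_range.mp hj)
  have h := HasStripCertificate.mul_pow_mul_pow (hb.isSumSq_aeval hj (hbpos j hj))
    (hb.totalDegree_aeval_le hj) j (N + d - j)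
  rwa [Nat.add_sub_of_le hj] at h
end
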